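/- arXiv:1406.2510 — 2 statements merged into one kernel-verified Lean document; each statement's English description precedes it below -/
import Mathlib

section
/- Let S be a skew lattice with D-classes A > B. Then: (1) every b ∈ B satisfies b ∈ b∧A; (2) for b, x ∈ B, x ∈ b∧A if and only if x∧A = b∧A (hence the right cosets of A in B form a partition of B); (3) for every b ∈ B, b∧A ⊆ A∧b∧A (hence the partition of B by right cosets of A in B refines the partition by cosets of A in B). -/
/-- A skew lattice: a set with two idempotent associative operations
satisfying the absorption laws. -/
class SkewLattice (S : Type*) where
  meet : S → S → S
  join : S → S → S
  meet_assoc : ∀ x y z : S, meet (meet x y) z = meet x (meet y z)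
  join_assoc : ∀ x y z : S, join (join x y) z = join x (join y z)
  meet_idem : ∀ x : S, meet x x = x
  join_idem : ∀ x : S, join x x = x
  absorb₁ : ∀ x y : S, meet x (join x y) = x
  absorb₂ : ∀ x y : S, meet (join y x) x = x
  absorb₃ : ∀ x y : S, join x (meet x y) = x
  absorb₄ : ∀ x y : S, join (meet y x) x = x

namespace SkewLattice

variable {S : Type*} [SkewLattice S]

local infixl:70 " ∧' " => SkewLattice.meet
local infixl:65 " ∨' " => SkewLattice.join

/-- The flat preorder `≤_L`: `x ≤_L y` iff `x ∧ y = x`. -/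
def leqL (x y : S) : Prop := x ∧' y = x

/-- The flat preorder `≤_R`: `x ≤_R y` iff `y ∧ x = x`. -/
def leqR (x y : S) : Prop := y ∧' x = x

/-- Green's relation `R`. -/
def relR (x y : S) : Prop := x ∧' y = y ∧ y ∧' x = x

/-- Green's relation `L`. -/
def relL (x y : S) : Prop := x ∧' y = x ∧ y ∧' x = y

/-- Green's relation `D`. -/
def relD (x y : S) : Prop := x ∧' y ∧' x = x ∧ y ∧' x ∧' y = y

/-- The natural preorder `⪯`. -/
def preceq (x y : S) : Prop := x ∧' y ∧' x = x

/-- A `D`-class: an equivalence class of Green's relation `D`. -/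
def IsDClass (A : Set S) : Prop := ∃ a : S, A = {x | relD x a}

/-- `A > B` for `D`-classes: `A` and `B` are `D`-classes with every element of `B`
strictly below every element of `A` in the natural preorder. -/
def classGT (A B : Set S) : Prop :=
  IsDClass A ∧ IsDClass B ∧ ∀ a ∈ A, ∀ b ∈ B, preceq b a ∧ ¬ preceq a b

/-- A skew diamond `{J > A, B > M}`: two incomparable `D`-classes `A`, `B`
together with the `D`-class `M` of `a ∧ b ∧ a` and the `D`-class `J` of
`a ∨ b ∨ a` for some `a ∈ A`, `b ∈ B`. -/
def IsSkewDiamond (J A B M : Set S) : Prop :=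
  IsDClass J ∧ IsDClass A ∧ IsDClass B ∧ IsDClass M ∧
  (∀ a ∈ A, ∀ b ∈ B, ¬ preceq a b ∧ ¬ preceq b a) ∧
  ∃ a ∈ A, ∃ b ∈ B, (a ∧' b ∧' a) ∈ M ∧ (a ∨' b ∨' a) ∈ J

theorem aux_sand (x p w q : S) (h : x = p ∧' w ∧' q) : x ∧' w ∧' x = x := by
  have h1 : x ∧' w ∧' q = x := by
    rw [h]
    calc p ∧' w ∧' q ∧' w ∧' q = p ∧' ((w ∧' q) ∧' (w ∧' q)) := by simp only [meet_assoc]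
      _ = p ∧' w ∧' q := by rw [meet_idem, meet_assoc]
  calc x ∧' w ∧' x = x ∧' w ∧' (x ∧' w ∧' q) := by rw [h1]
    _ = ((x ∧' w) ∧' (x ∧' w)) ∧' q := by simp only [meet_assoc]
    _ = x := by rw [meet_idem, h1]

theorem aux_trans (u a v : S) (h1 : u ∧' a ∧' u = u) (h2 : a ∧' v ∧' a = a) :
    u ∧' v ∧' u = u := by
  apply aux_sand u (u ∧' a) v (a ∧' u)
  calc u = u ∧' (a ∧' v ∧' a) ∧' u := by rw [h2, h1]
    _ = _ := by simp only [meet_assoc]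

theorem aux_mul (a u v : S) (hu : relD u a) (hv : relD v a) : relD (u ∧' v) a := by
  constructor
  · apply aux_sand _ u a (u ∧' v)
    calc u ∧' v = (u ∧' a ∧' u) ∧' v := by rw [hu.1]
      _ = _ := by simp only [meet_assoc]
  · apply aux_sand _ (a ∧' v ∧' a) (u ∧' v) (a ∧' u ∧' a)
    have e : a = (a ∧' v) ∧' (a ∧' u) ∧' a := by
      calc a = (a ∧' v ∧' a) ∧' (u ∧' a) := by rw [hv.2, ← meet_assoc, hu.2]
        _ = _ := by simp only [meet_assoc]
    calc a = a ∧' ((v ∧' a ∧' u) ∧' a) := by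
            calc a = _ := e
              _ = _ := by simp only [meet_assoc]
      _ = a ∧' (((v ∧' a ∧' u) ∧' (v ∧' a ∧' u)) ∧' a) := by rw [meet_idem]
      _ = _ := by simp only [meet_assoc]

theorem aux_join (a b : S) (h : b ∧' a ∧' b = b) : a ∨' b ∨' a = a := by
  have h1 : b ∨' (a ∧' b) = a ∧' b := by
    have := absorb₄ (a ∧' b) b
    rwa [← meet_assoc, h] at this
  have h2 : a ∨' b ∨' (a ∧' b) = a := by rw [join_assoc, h1, absorb₃]
  calc a ∨' b ∨' a = a ∨' b ∨' (a ∨' b ∨' (a ∧' b)) := by rw [h2]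
    _ = ((a ∨' b) ∨' (a ∨' b)) ∨' (a ∧' b) := by simp only [join_assoc]
    _ = a := by rw [join_idem, h2]

theorem aux_t (a b : S) (h : b ∧' a ∧' b = b) : relD (b ∨' a) a := by
  have h1 : (b ∨' a) ∧' a = a := absorb₂ a b
  have h2 : a ∧' (b ∨' a) = b ∨' a := by
    have := absorb₂ (b ∨' a) a
    rwa [← join_assoc, aux_join a b h] at this
  exact ⟨by rw [h1, h2], by rw [h2, h1]⟩

theorem aux_s (a b : S) (h : b ∧' a ∧' b = b) : relD (a ∨' b) a := by
  have h1 : a ∧' (a ∨' b) = a := absorb₁ a b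
  have h2 : (a ∨' b) ∧' a = a ∨' b := by
    have := absorb₁ (a ∨' b) a
    rwa [aux_join a b h] at this
  exact ⟨by rw [h2, meet_idem], by rw [h1, meet_idem]⟩

/-- right cosets of `A` in `B` partition `B` and refine the
partition by full cosets. -/
theorem rightCoset_partition (A B : Set S) (hAB : classGT A B) :
    (∀ b ∈ B, b ∈ {z : S | ∃ u ∈ A, z = b ∧' u}) ∧
    (∀ b ∈ B, ∀ x ∈ B, (x ∈ {z : S | ∃ u ∈ A, z = b ∧' u} ↔
      {z : S | ∃ u ∈ A, z = x ∧' u} = {z : S | ∃ u ∈ A, z = b ∧' u})) ∧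
    (∀ b ∈ B, {z : S | ∃ u ∈ A, z = b ∧' u} ⊆ {z : S | ∃ u ∈ A, z = u ∧' b ∧' u}) := by
  obtain ⟨⟨a, rfl⟩, -, hlt⟩ := hAB
  have haa : relD a a := by constructor <;> simp only [meet_idem]
  have hpre : ∀ b ∈ B, b ∧' a ∧' b = b := fun b hb => (hlt a haa b hb).1
  have hT : ∀ b ∈ B, ∃ t, relD t a ∧ b ∧' t = b := fun b hb =>
    ⟨b ∨' a, aux_t a b (hpre b hb), absorb₁ b a⟩
  have hS : ∀ b ∈ B, ∃ s, relD s a ∧ s ∧' b = b := fun b hb =>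
    ⟨a ∨' b, aux_s a b (hpre b hb), absorb₂ b a⟩
  have hrect : ∀ u v : S, relD u a → relD v a → u ∧' v ∧' u = u := fun u v hu hv =>
    aux_trans u a v hu.1 hv.2
  have h1 : ∀ b ∈ B, b ∈ {z : S | ∃ u ∈ {x | relD x a}, z = b ∧' u} := by
    intro b hb
    obtain ⟨t, ht, e⟩ := hT b hb
    exact ⟨t, ht, e.symm⟩
  refine ⟨h1, ?_, ?_⟩
  · intro b hb x hx
    constructor
    · rintro ⟨u, hu, rfl⟩
      ext z
      constructor
      · rintro ⟨v, hv, rfl⟩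
        exact ⟨u ∧' v, aux_mul a u v hu hv, meet_assoc _ _ _⟩
      · rintro ⟨v, hv, rfl⟩
        obtain ⟨t, ht, e⟩ := hT b hb
        refine ⟨t ∧' v, aux_mul a t v ht hv, ?_⟩
        calc b ∧' v = b ∧' (t ∧' u ∧' t) ∧' v := by rw [hrect t u ht hu, e]
          _ = (b ∧' t) ∧' u ∧' (t ∧' v) := by simp only [meet_assoc]
          _ = _ := by rw [e]
    · intro h
      rw [← h]
      exact h1 x hx
  · rintro b hb z ⟨u, hu, rfl⟩
    obtain ⟨t, ht, e⟩ := hT b hb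
    obtain ⟨s, hs, f⟩ := hS b hb
    have htu := aux_mul a t u ht hu
    refine ⟨s ∧' (t ∧' u), aux_mul a _ _ hs htu, ?_⟩
    have e1 : s ∧' (t ∧' u) ∧' b = b := by
      calc s ∧' (t ∧' u) ∧' b = s ∧' (t ∧' u) ∧' (s ∧' b) := by rw [f]
        _ = (s ∧' (t ∧' u) ∧' s) ∧' b := by simp only [meet_assoc]
        _ = b := by rw [hrect s _ hs htu, f]
    rw [e1]
    calc b ∧' u = b ∧' (t ∧' s ∧' t) ∧' u := by rw [hrect t s ht hs, e]
      _ = (b ∧' t) ∧' (s ∧' (t ∧' u)) := by simp only [meet_assoc]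
      _ = _ := by rw [e]

end SkewLattice
end

section
/- Let S be a skew lattice with D-classes A > B, and let x, y ∈ B and u, v ∈ A. Then: (i) x∧A = y∧A if and only if A∧x∧A = A∧y∧A and x R y; (ii) A∧x = A∧y if and only if A∧x∧A = A∧y∧A and x L y; (iii) B∨u = B∨v if and only if B∨u∨B = B∨v∨B and u R v; (iv) u∨B = v∨B if and only if B∨u∨B = B∨v∨B and u L v. -/
namespace SkewLattice

variable {S : Type*} [SkewLattice S]

local infixl:70 " ∧' " => SkewLattice.meet
local infixl:65 " ∨' " => SkewLattice.join

theorem aux_key {e a g b : S} (h : e = a ∧' g ∧' b) : e ∧' g ∧' e = e := by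
  have h1 : e ∧' (g ∧' b) = e := by
    conv_lhs => rw [h]
    rw [meet_assoc a g b, meet_assoc, meet_idem, ← meet_assoc, ← h]
  calc e ∧' g ∧' e = e ∧' g ∧' (e ∧' (g ∧' b)) := by rw [h1]
    _ = ((e ∧' g) ∧' (e ∧' g)) ∧' b := by simp only [meet_assoc]
    _ = e := by rw [meet_idem, meet_assoc, h1]

theorem aux_trans_s11 {x y z : S} (h1 : preceq x y) (h2 : preceq y z) : preceq x z := by
  unfold preceq at *
  apply aux_key (a := x ∧' y) (b := y ∧' x)
  calc x = x ∧' y ∧' x := h1.symm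
    _ = x ∧' (y ∧' z ∧' y) ∧' x := by rw [h2]
    _ = _ := by simp only [meet_assoc]

/-- dual -/
@[reducible] def dualInst (I : SkewLattice S) : SkewLattice S where
  meet := I.join
  join := I.meet
  meet_assoc := I.join_assoc
  join_assoc := I.meet_assoc
  meet_idem := I.join_idem
  join_idem := I.meet_idem
  absorb₁ := I.absorb₃
  absorb₂ := I.absorb₄
  absorb₃ := I.absorb₁
  absorb₄ := I.absorb₂

/-- opposite -/
@[reducible] def opInst (I : SkewLattice S) : SkewLattice S where
  meet x y := I.meet y x
  join x y := I.join y x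
  meet_assoc x y z := (I.meet_assoc z y x).symm
  join_assoc x y z := (I.join_assoc z y x).symm
  meet_idem := I.meet_idem
  join_idem := I.join_idem
  absorb₁ := I.absorb₂
  absorb₂ := I.absorb₁
  absorb₃ := I.absorb₄
  absorb₄ := I.absorb₃

theorem aux_join_s11 {x w : S} (h : preceq x w) : w ∨' x ∨' w = w := by
  unfold preceq at h
  have e1 : x ∨' (w ∧' x) = w ∧' x := by
    have := absorb₄ (w ∧' x) x
    rwa [← meet_assoc, h] at this
  have e2 : (x ∧' w) ∨' x = x ∧' w := by
    have := absorb₃ (x ∧' w) x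
    rwa [h] at this
  have w1 : w = w ∨' (x ∨' (w ∧' x)) := by rw [e1, absorb₃]
  refine @aux_key S (dualInst inferInstance) w w x ((w ∧' x) ∨' w) ?_
  show w = w ∨' x ∨' ((w ∧' x) ∨' w)
  calc w = w ∨' w := (join_idem w).symm
    _ = (w ∨' (x ∨' (w ∧' x))) ∨' w := by rw [← w1]
    _ = _ := by simp only [join_assoc]

theorem aux_join_iff {x w : S} : preceq x w ↔ w ∨' x ∨' w = w :=
  ⟨aux_join_s11, fun h => @aux_join_s11 S (dualInst inferInstance) w x h⟩

theorem aux_reg {w w' y : S} (h1 : preceq w w') :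
    w ∧' y ∧' w' ∧' w = w ∧' y ∧' w := by
  obtain ⟨t, ht⟩ : ∃ t, t = w ∧' y := ⟨_, rfl⟩
  have wt : w ∨' t = w := by rw [ht, absorb₃]
  obtain ⟨z, hz⟩ : ∃ z, z = t ∨' w := ⟨_, rfl⟩
  have tz : t ∧' z = t := by rw [hz, absorb₁]
  have zw : z ∧' w = w := by rw [hz, absorb₂]
  have wz : w ∧' z = z := by
    have : w ∨' z = w := by rw [hz, ← join_assoc, wt, join_idem]
    have h := absorb₂ z w
    rwa [this] at h
  have zz : preceq z w := by
    unfold preceq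
    rw [meet_assoc, wz, meet_idem]
  have h3 : z ∧' w' ∧' z = z := aux_trans_s11 zz h1
  have h4 : z ∧' (w' ∧' w) = w := by
    calc z ∧' (w' ∧' w) = z ∧' w' ∧' z ∧' w := by
          conv_lhs => rw [← zw]
          simp only [meet_assoc]
      _ = w := by rw [h3, zw]
  rw [← ht]
  calc t ∧' w' ∧' w = (t ∧' z) ∧' w' ∧' w := by rw [tz]
    _ = t ∧' (z ∧' (w' ∧' w)) := by simp only [meet_assoc]
    _ = t ∧' w := by rw [h4]

theorem aux_mem {A : Set S} (hA : ∀ a ∈ A, ∀ z, z ∈ A ↔ relD z a) {x w : S}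
    (hw : w ∈ A) (h : preceq x w) : ∃ z ∈ A, x ∧' z = x := by
  refine ⟨x ∨' w ∨' x, (hA w hw _).2 ⟨?_, ?_⟩, by rw [join_assoc, absorb₁]⟩
  · apply aux_join_iff.2
    have := aux_join_s11 h
    calc w ∨' (x ∨' w ∨' x) ∨' w = (w ∨' x ∨' w) ∨' x ∨' w := by simp only [join_assoc]
      _ = w := by rw [this, this]
  · apply aux_join_iff.2
    calc x ∨' w ∨' x ∨' w ∨' (x ∨' w ∨' x)
        = x ∨' ((w ∨' x ∨' w) ∨' x ∨' w) ∨' x := by simp only [join_assoc]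
      _ = _ := by rw [aux_join_s11 h, aux_join_s11 h]

theorem aux_sub {A : Set S} {x y : S}
    (hx : ∀ a ∈ A, preceq x a) (hR : relR x y)
    (h : {z : S | ∃ w ∈ A, z = w ∧' x ∧' w} = {z : S | ∃ w ∈ A, z = w ∧' y ∧' w}) :
    {z : S | ∃ w ∈ A, z = x ∧' w} ⊆ {z : S | ∃ w ∈ A, z = y ∧' w} := by
  rintro _ ⟨w, hw, rfl⟩
  obtain ⟨v, hv, e⟩ : w ∧' x ∧' w ∈ {z : S | ∃ w ∈ A, z = w ∧' y ∧' w} := h ▸ ⟨w, hw, rfl⟩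
  refine ⟨v, hv, ?_⟩
  have h1 : x ∧' w ∧' x = x := hx w hw
  have h2 : x ∧' v ∧' x = x := hx v hv
  calc x ∧' w = (x ∧' w ∧' x) ∧' w := by rw [h1]
    _ = x ∧' (w ∧' x ∧' w) := by simp only [meet_assoc]
    _ = x ∧' (v ∧' (x ∧' y) ∧' v) := by rw [e, hR.1]
    _ = (x ∧' v ∧' x) ∧' y ∧' v := by simp only [meet_assoc]
    _ = y ∧' v := by rw [h2, hR.1]

theorem aux_main {A : Set S} (hA : ∀ a ∈ A, ∀ z, z ∈ A ↔ relD z a) {u x y : S} (hu : u ∈ A)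
    (hx : ∀ a ∈ A, preceq x a) (hy : ∀ a ∈ A, preceq y a) :
    {z : S | ∃ w ∈ A, z = x ∧' w} = {z : S | ∃ w ∈ A, z = y ∧' w} ↔
      ({z : S | ∃ w ∈ A, z = w ∧' x ∧' w} = {z : S | ∃ w ∈ A, z = w ∧' y ∧' w}
        ∧ relR x y) := by
  constructor
  · intro h
    obtain ⟨a, ha, ea⟩ := aux_mem hA hu (hx u hu)
    obtain ⟨b, hb, eb⟩ := aux_mem hA hu (hy u hu)
    obtain ⟨c, hc, ec⟩ : x ∈ {z : S | ∃ w ∈ A, z = y ∧' w} := h ▸ ⟨a, ha, ea.symm⟩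
    obtain ⟨d, hd, ed⟩ : y ∈ {z : S | ∃ w ∈ A, z = x ∧' w} := h ▸ ⟨b, hb, eb.symm⟩
    have key : ∀ w ∈ A, w ∧' x ∧' w = w ∧' y ∧' w := by
      intro w hw
      rw [ec, ← meet_assoc]
      exact aux_reg ((hA c hc w).1 hw).1
    refine ⟨?_, ?_, ?_⟩
    · ext z
      constructor
      · rintro ⟨w, hw, rfl⟩
        exact ⟨w, hw, key w hw⟩
      · rintro ⟨w, hw, rfl⟩
        exact ⟨w, hw, (key w hw).symm⟩
    · rw [ed, ← meet_assoc, meet_idem]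
    · rw [ec, ← meet_assoc, meet_idem]
  · rintro ⟨h, hR⟩
    exact Set.Subset.antisymm (aux_sub hx hR h) (aux_sub hy ⟨hR.2, hR.1⟩ h.symm)

theorem aux_main_op {A : Set S} (hA : ∀ a ∈ A, ∀ z, z ∈ A ↔ relD z a) {u x y : S} (hu : u ∈ A)
    (hx : ∀ a ∈ A, preceq x a) (hy : ∀ a ∈ A, preceq y a) :
    {z : S | ∃ w ∈ A, z = w ∧' x} = {z : S | ∃ w ∈ A, z = w ∧' y} ↔
      ({z : S | ∃ w ∈ A, z = w ∧' x ∧' w} = {z : S | ∃ w ∈ A, z = w ∧' y ∧' w}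
        ∧ relL x y) := by
  have as : ∀ p q r : S, p ∧' (q ∧' r) = p ∧' q ∧' r := fun p q r => (meet_assoc p q r).symm
  have hA' : ∀ a ∈ A, ∀ z, z ∈ A ↔ (z ∧' (a ∧' z) = z ∧ a ∧' (z ∧' a) = a) := by
    simpa only [relD, as] using hA
  have hx' : ∀ a ∈ A, x ∧' (a ∧' x) = x := by simpa only [preceq, as] using hx
  have hy' : ∀ a ∈ A, y ∧' (a ∧' y) = y := by simpa only [preceq, as] using hy
  have H : {z : S | ∃ w ∈ A, z = w ∧' x} = {z : S | ∃ w ∈ A, z = w ∧' y} ↔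
      ({z : S | ∃ w ∈ A, z = w ∧' (x ∧' w)} = {z : S | ∃ w ∈ A, z = w ∧' (y ∧' w)}
        ∧ (y ∧' x = y ∧ x ∧' y = x)) :=
    @aux_main S (opInst inferInstance) A hA' u x y hu hx' hy'
  simp only [as] at H
  rw [H, relL, and_comm (a := y ∧' x = y)]

theorem aux_class {A : Set S} (h : IsDClass A) : ∀ a ∈ A, ∀ z, z ∈ A ↔ relD z a := by
  obtain ⟨c, rfl⟩ := h
  rintro a ⟨h1, h2⟩ z
  exact ⟨fun h => ⟨aux_trans_s11 h.1 h2, aux_trans_s11 h1 h.2⟩,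
    fun h => ⟨aux_trans_s11 h.1 h1, aux_trans_s11 h2 h.2⟩⟩

theorem aux_abs {x y : S} : x ∧' y = x ↔ x ∨' y = y :=
  ⟨fun h => by rw [← h, absorb₄], fun h => by rw [← h, absorb₁]⟩

theorem aux_abs2 {x y : S} : x ∧' y = y ↔ x ∨' y = x :=
  ⟨fun h => by rw [← h, absorb₃], fun h => by rw [← h, absorb₂]⟩

/-- flat cosets versus full cosets and Green's relations. -/
theorem flatCoset_iff_fullCoset (A B : Set S) (hAB : classGT A B)
    (x y : S) (hx : x ∈ B) (hy : y ∈ B)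
    (u v : S) (hu : u ∈ A) (hv : v ∈ A) :
    ({z : S | ∃ w ∈ A, z = x ∧' w} = {z : S | ∃ w ∈ A, z = y ∧' w} ↔
      ({z : S | ∃ w ∈ A, z = w ∧' x ∧' w} = {z : S | ∃ w ∈ A, z = w ∧' y ∧' w}
        ∧ relR x y)) ∧
    ({z : S | ∃ w ∈ A, z = w ∧' x} = {z : S | ∃ w ∈ A, z = w ∧' y} ↔
      ({z : S | ∃ w ∈ A, z = w ∧' x ∧' w} = {z : S | ∃ w ∈ A, z = w ∧' y ∧' w}
        ∧ relL x y)) ∧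
    ({z : S | ∃ w ∈ B, z = w ∨' u} = {z : S | ∃ w ∈ B, z = w ∨' v} ↔
      ({z : S | ∃ w ∈ B, z = w ∨' u ∨' w} = {z : S | ∃ w ∈ B, z = w ∨' v ∨' w}
        ∧ relR u v)) ∧
    ({z : S | ∃ w ∈ B, z = u ∨' w} = {z : S | ∃ w ∈ B, z = v ∨' w} ↔
      ({z : S | ∃ w ∈ B, z = w ∨' u ∨' w} = {z : S | ∃ w ∈ B, z = w ∨' v ∨' w}
        ∧ relL u v)) := by
  obtain ⟨hA, hB, hlt⟩ := hAB
  have cA := aux_class hA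
  have cB := aux_class hB
  have cB' : ∀ a ∈ B, ∀ z, z ∈ B ↔ @relD S (dualInst inferInstance) z a := by
    intro a ha z
    rw [cB a ha z]
    exact and_comm.trans (and_congr aux_join_iff aux_join_iff)
  have lt' : ∀ u ∈ A, ∀ b ∈ B, @preceq S (dualInst inferInstance) u b :=
    fun u hu b hb => aux_join_s11 (hlt u hu b hb).1
  have RL : @relR S (dualInst inferInstance) u v ↔ relL u v :=
    and_congr aux_abs.symm aux_abs.symm
  have LR : @relL S (dualInst inferInstance) u v ↔ relR u v :=
    and_congr aux_abs2.symm aux_abs2.symm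
  refine ⟨aux_main cA hu (fun a ha => (hlt a ha x hx).1) (fun a ha => (hlt a ha y hy).1),
    aux_main_op cA hu (fun a ha => (hlt a ha x hx).1) (fun a ha => (hlt a ha y hy).1), ?_, ?_⟩
  · rw [← LR]
    exact @aux_main_op S (dualInst inferInstance) B cB' x u v hx (lt' u hu) (lt' v hv)
  · rw [← RL]
    exact @aux_main S (dualInst inferInstance) B cB' x u v hx (lt' u hu) (lt' v hv)

end SkewLattice
end
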